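/- For every x_i ∈ ℝ³ with ‖x_i‖ = 1 and every x with ‖x‖ = 1 and x ≠ x_i, the radial derivative of the exterior surface Neumann Green's function vanishes at x: (d/dt) G_s(t·x; x_i) |_{t=1} = 0. That is, G_s(·; x_i) satisfies a homogeneous Neumann condition on the unit sphere away from the singular point x_i. -/

import Mathlib

open Real Filter Topology

/-- The exterior surface Neumann Green's function of the unit sphere. -/
noncomputable def Gs (xi x : EuclideanSpace ℝ (Fin 3)) : ℝ :=
  1 / (2 * π * ‖x - xi‖) -
    1 / (4 * π) * Real.log (1 + 2 / (‖x - xi‖ + ‖x‖ - 1))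

/-- Homogeneous Neumann condition on the unit sphere away from the singular
point: the radial derivative of `G_s(·;x_i)` vanishes at every point `x ≠ x_i`
of the unit sphere. -/
theorem stmt10 (xi : EuclideanSpace ℝ (Fin 3)) (hxi : ‖xi‖ = 1)
    (x : EuclideanSpace ℝ (Fin 3)) (hx : ‖x‖ = 1) (hne : x ≠ xi) :
    deriv (fun t : ℝ => Gs xi (t • x)) 1 = 0 := by
  have hd0 : 0 < ‖x - xi‖ := norm_pos_iff.mpr (sub_ne_zero.mpr hne)
  obtain ⟨d, hd⟩ : ∃ d, d = ‖x - xi‖ := ⟨_, rfl⟩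
  obtain ⟨c, hc⟩ : ∃ c : ℝ, c = inner ℝ x xi := ⟨_, rfl⟩
  rw [← hd] at hd0
  have hnorm : ∀ t : ℝ, ‖t • x - xi‖ = Real.sqrt (t ^ 2 - 2 * t * c + 1) := by
    intro t
    rw [← Real.sqrt_sq (norm_nonneg (t • x - xi)), norm_sub_sq_real, norm_smul, hx, hxi,
      real_inner_smul_left, ← hc]
    congr 1
    simp
    ring
  have hdc : d = Real.sqrt ((1 : ℝ) ^ 2 - 2 * 1 * c + 1) := by
    rw [← hnorm 1, one_smul, hd]
  have hpos : 0 < (1 : ℝ) ^ 2 - 2 * 1 * c + 1 := by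
    rw [hdc] at hd0
    exact Real.sqrt_pos.mp hd0
  have hd2 : d ^ 2 = 2 - 2 * c := by
    rw [hdc, Real.sq_sqrt hpos.le]; ring
  have hev : (fun t : ℝ => Gs xi (t • x)) =ᶠ[𝓝 1] fun t : ℝ =>
      1 / (2 * π * Real.sqrt (t ^ 2 - 2 * t * c + 1)) -
      1 / (4 * π) * Real.log (1 + 2 / (Real.sqrt (t ^ 2 - 2 * t * c + 1) + t - 1)) := by
    filter_upwards [lt_mem_nhds (zero_lt_one' ℝ)] with t ht
    rw [Gs, hnorm, norm_smul, hx, Real.norm_of_nonneg ht.le, mul_one]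
  rw [hev.deriv_eq]
  have hq : HasDerivAt (fun t : ℝ => t ^ 2 - 2 * t * c + 1) (2 - 2 * c) 1 := by
    have h := (((hasDerivAt_id (1 : ℝ)).pow 2).sub
      (((hasDerivAt_id (1 : ℝ)).const_mul 2).mul_const c)).add_const 1
    refine h.congr_deriv ?_
    simp
  have hs : HasDerivAt (fun t : ℝ => Real.sqrt (t ^ 2 - 2 * t * c + 1)) (d / 2) 1 := by
    convert hq.sqrt hpos.ne' using 1
    rw [← hdc, ← hd2]
    field_simp
  have hden : HasDerivAt (fun t : ℝ => Real.sqrt (t ^ 2 - 2 * t * c + 1) + t - 1)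
      (d / 2 + 1) 1 := (hs.add (hasDerivAt_id (1 : ℝ))).sub_const 1
  have hval : Real.sqrt ((1 : ℝ) ^ 2 - 2 * 1 * c + 1) + 1 - 1 = d := by rw [← hdc]; ring
  have hpi := Real.pi_pos
  have h1 := (hasDerivAt_const (1 : ℝ) (1 : ℝ)).div (hs.const_mul (2 * π))
    (by rw [← hdc]; positivity)
  have h2 := ((hasDerivAt_const (1 : ℝ) (2 : ℝ)).div hden
    (by rw [hval]; positivity)).const_add 1
  have h3 := (h2.log (by simp only [Pi.div_apply]; rw [hval]; positivity)).const_mul (1 / (4 * π))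
  have h4 := h1.sub h3
  refine (HasDerivAt.deriv (h4.congr_deriv ?_))
  simp only [Pi.div_apply]
  rw [hval, ← hdc]
  field_simp
  ring
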